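/- Let T = (a, a', a'', e, e', e'') be a potential blocking tuple for a matching μ in the affiliate matching problem in which e' and a'' are dummies, and let μ* be the swapped matching of μ with respect to T. Suppose a' ∈ aff(e), a ∉ aff(e), pr_e^{a'}(e) = 1, pr_e^e(a') = 0, and pr_e^e(a) = 0. Then val_e(μ*) ≤ val_e(μ); in particular, e does not strictly prefer μ* to μ. -/

import Mathlib

open Finset

/-- The set of employers matched to applicant `a` in the matching `μ` (viewed as a set of
applicant–employer pairs). -/
def matchedE {A E : Type*} [DecidableEq A] [DecidableEq E] (μ : Finset (A × E)) (a : A) :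
    Finset E :=
  (μ.filter fun p => p.1 = a).image Prod.snd

/-- The set of applicants matched to employer `e` in the matching `μ`. -/
def matchedA {A E : Type*} [DecidableEq A] [DecidableEq E] (μ : Finset (A × E)) (e : E) :
    Finset A :=
  (μ.filter fun p => p.2 = e).image Prod.fst

/-- The valuation of applicant `a` for the matching `μ`:  `val_a(μ) = ∑_{e ∈ μ(a)} pr_a(e)`. -/
def valA {A E : Type*} [DecidableEq A] [DecidableEq E] (prA : A → E → ℝ)
    (μ : Finset (A × E)) (a : A) : ℝ :=
  ∑ x ∈ matchedE μ a, prA a x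

/-- The valuation of employer `e` for the matching `μ`:
`val_e(μ) = ∑_{a ∈ μ(e)} pr_e^e(a) + λ ∑_{a ∈ aff(e)} ∑_{e* ∈ μ(a)} pr_e^a(e*)`. -/
def valE {A E : Type*} [DecidableEq A] [DecidableEq E] (aff : E → Finset A) (lam : ℝ)
    (prEE : E → A → ℝ) (prEA : E → A → E → ℝ) (μ : Finset (A × E)) (e : E) : ℝ :=
  ∑ b ∈ matchedA μ e, prEE e b + lam * ∑ b ∈ aff e, ∑ x ∈ matchedE μ b, prEA e b x

/-- `μ` is a matching respecting the capacity quotas `qA` (applicants) and `qE` (employers). -/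
def IsMatching {A E : Type*} [DecidableEq A] [DecidableEq E] (qA : A → ℕ) (qE : E → ℕ)
    (μ : Finset (A × E)) : Prop :=
  (∀ a, (matchedE μ a).card ≤ qA a) ∧ ∀ e, (matchedA μ e).card ≤ qE e

/-- The pair `(a, e)` as a (possibly empty) finite set, where `a` and `e` may be dummies. -/
def optPair {A E : Type*} : Option A → Option E → Finset (A × E)
  | some a, some e => {(a, e)}
  | _, _ => ∅

/-- The swapped matching of `μ` with respect to the tuple `(a, a', a'', e, e', e'')`:
add the pair `(a, e)`, remove the pairs `(a, e')` and `(a', e)` when the corresponding entries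
are non-dummy, and add the pairs `(a'', e')` and `(a', e'')` when the corresponding entries are
non-dummy. -/
def swapped {A E : Type*} [DecidableEq A] [DecidableEq E] (μ : Finset (A × E)) (a : A)
    (a' a'' : Option A) (e : E) (e' e'' : Option E) : Finset (A × E) :=
  ((μ \ (optPair (some a) e' ∪ optPair a' (some e))) ∪ {(a, e)})
    ∪ optPair a'' e' ∪ optPair a' e''

/-- `(a, a', a'', e, e', e'')` is a potential blocking tuple for `μ`:  `e ∉ μ(a)`,
`e'` is an element of `μ(a)` or a dummy, `a'` is an element of `μ(e)` or a dummy, and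
`a''` and `e''` are an applicant other than `a` and an employer other than `e`, or dummies. -/
def IsPotentialBlockingTuple {A E : Type*} [DecidableEq A] [DecidableEq E]
    (μ : Finset (A × E)) (a : A) (a' a'' : Option A) (e : E) (e' e'' : Option E) : Prop :=
  (a, e) ∉ μ ∧ (∀ x, e' = some x → (a, x) ∈ μ) ∧ (∀ b, a' = some b → (b, e) ∈ μ) ∧
    a'' ≠ some a ∧ e'' ≠ some e

/-- `pr_e^e(·)` extended to a possibly-dummy applicant argument (dummy values are `0`). -/
def prEEo {A E : Type*} (prEE : E → A → ℝ) (e : E) : Option A → ℝ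
  | some b => prEE e b
  | none => 0

/-- `pr_e^{·}(·)` extended to possibly-dummy arguments (dummy values are `0`). -/
def prEAo {A E : Type*} (prEA : E → A → E → ℝ) (e : E) : Option A → Option E → ℝ
  | some b, some x => prEA e b x
  | _, _ => 0

/-- The indicator that a possibly-dummy applicant belongs to `aff(e)`. -/
def affInd {A E : Type*} [DecidableEq A] (aff : E → Finset A) (e : E) : Option A → ℝ
  | some b => if b ∈ aff e then 1 else 0
  | none => 0

theorem mem_matchedE {A E : Type*} [DecidableEq A] [DecidableEq E] {μ : Finset (A × E)}
    {a : A} {x : E} : x ∈ matchedE μ a ↔ (a, x) ∈ μ := by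
  simp [matchedE]

theorem mem_matchedA {A E : Type*} [DecidableEq A] [DecidableEq E] {μ : Finset (A × E)}
    {a : A} {e : E} : a ∈ matchedA μ e ↔ (a, e) ∈ μ := by
  simp [matchedA]

theorem mem_swapped_none_none {A E : Type*} [DecidableEq A] [DecidableEq E]
    {μ : Finset (A × E)} {a b c : A} {e x : E} {e'' : Option E} :
    (c, x) ∈ swapped μ a (some b) none e none e'' ↔
      ((c, x) ∈ μ ∧ ¬ (c = b ∧ x = e)) ∨ (c = a ∧ x = e) ∨ (c = b ∧ e'' = some x) := by
  cases e'' <;> simp [swapped, optPair, or_assoc, or_comm, eq_comm]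

theorem sum_insert_le_add_of_nonneg {ι : Type*} [DecidableEq ι] (s : Finset ι) (i : ι)
    {f : ι → ℝ} (hf : 0 ≤ f i) : ∑ j ∈ insert i s, f j ≤ f i + ∑ j ∈ s, f j := by
  by_cases hi : i ∈ s
  · rw [insert_eq_of_mem hi]
    linarith
  · rw [sum_insert hi]

/-- Let `T = (a, a', a'', e, e', e'')` be a potential blocking tuple for `μ` in
which `e'` and `a''` are dummies, and `μ*` the swapped matching of `μ` w.r.t. `T`.  Suppose
`a' ∈ aff(e)` (with `a' = some b` non-dummy), `a ∉ aff(e)`, `pr_e^{a'}(e) = 1`,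
`pr_e^e(a') = 0`, and `pr_e^e(a) = 0`.  Then `val_e(μ*) ≤ val_e(μ)`; in particular `e` does
not strictly prefer `μ*` to `μ`. -/
theorem swap_case_affiliate_likes_employer {A E : Type*} [DecidableEq A] [DecidableEq E]
    (aff : E → Finset A) (lam : ℝ) (hlam : 0 < lam)
    (prA : A → E → ℝ) (prEE : E → A → ℝ) (prEA : E → A → E → ℝ)
    (hprA : ∀ a e, prA a e = 0 ∨ prA a e = 1)
    (hprEE : ∀ e b, prEE e b = 0 ∨ prEE e b = 1)
    (hprEA : ∀ e b x, prEA e b x = 0 ∨ prEA e b x = 1)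
    (qA : A → ℕ) (qE : E → ℕ) (μ : Finset (A × E)) (hμ : IsMatching qA qE μ)
    (a : A) (a' : Option A) (e : E) (e'' : Option E)
    (hT : IsPotentialBlockingTuple μ a a' (none : Option A) e (none : Option E) e'')
    (b : A) (hb : a' = some b)
    (hbaff : b ∈ aff e) (haff : a ∉ aff e)
    (hb1 : prEA e b e = 1) (hb2 : prEE e b = 0) (ha0 : prEE e a = 0) :
    valE aff lam prEE prEA (swapped μ a a' none e none e'') e ≤ valE aff lam prEE prEA μ e ∧
      ¬ valE aff lam prEE prEA μ e <
          valE aff lam prEE prEA (swapped μ a a' none e none e'') e := by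
  subst hb
  obtain ⟨-, -, hbμ, -, he''⟩ := hT
  have hbe : (b, e) ∈ μ := hbμ b rfl
  have hEE : ∀ c, 0 ≤ prEE e c := fun c => by rcases hprEE e c with h | h <;> simp [h]
  have hEA : ∀ c x, 0 ≤ prEA e c x := fun c x => by rcases hprEA e c x with h | h <;> simp [h]
  have hEA1 : ∀ c x, prEA e c x ≤ 1 := fun c x => by rcases hprEA e c x with h | h <;> simp [h]
  have hown : ∑ c ∈ matchedA (swapped μ a (some b) none e none e'') e, prEE e c ≤
      ∑ c ∈ matchedA μ e, prEE e c := by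
    have hsub : matchedA (swapped μ a (some b) none e none e'') e ⊆
        insert a (matchedA μ e) := by
      intro c hc
      rw [mem_matchedA, mem_swapped_none_none] at hc
      rw [mem_insert, mem_matchedA]
      tauto
    calc _ ≤ ∑ c ∈ insert a (matchedA μ e), prEE e c :=
          sum_le_sum_of_subset_of_nonneg hsub fun c _ _ => hEE c
      _ ≤ prEE e a + ∑ c ∈ matchedA μ e, prEE e c :=
          sum_insert_le_add_of_nonneg _ _ (hEE a)
      _ = _ := by rw [ha0, zero_add]
  have haffil : ∀ c ∈ aff e,
      ∑ x ∈ matchedE (swapped μ a (some b) none e none e'') c, prEA e c x ≤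
        ∑ x ∈ matchedE μ c, prEA e c x := by
    intro c hc
    have hca : c ≠ a := fun h => haff (h ▸ hc)
    by_cases hcb : c = b
    · subst hcb
      have hsplit := add_sum_erase (matchedE μ c) (prEA e c) (mem_matchedE.2 hbe)
      rw [← hsplit, hb1]
      cases e'' with
      | none =>
        have hsub : matchedE (swapped μ a (some c) none e none none) c ⊆
            (matchedE μ c).erase e := by
          intro x hx
          rw [mem_matchedE, mem_swapped_none_none] at hx
          rw [mem_erase, mem_matchedE]
          simp_all
        have := sum_le_sum_of_subset_of_nonneg hsub fun x _ _ => hEA c x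
        linarith
      | some y =>
        have hsub : matchedE (swapped μ a (some c) none e none (some y)) c ⊆
            insert y ((matchedE μ c).erase e) := by
          intro x hx
          rw [mem_matchedE, mem_swapped_none_none] at hx
          rw [mem_insert, mem_erase, mem_matchedE]
          grind
        have hle := sum_le_sum_of_subset_of_nonneg hsub fun x _ _ => hEA c x
        have hins := sum_insert_le_add_of_nonneg ((matchedE μ c).erase e) y (hEA c y)
        linarith [hEA1 c y]
    · refine sum_le_sum_of_subset_of_nonneg (fun x hx => ?_) fun x _ _ => hEA c x
      rw [mem_matchedE, mem_swapped_none_none] at hx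
      rw [mem_matchedE]
      tauto
  have hval : valE aff lam prEE prEA (swapped μ a (some b) none e none e'') e ≤
      valE aff lam prEE prEA μ e :=
    add_le_add hown (mul_le_mul_of_nonneg_left (sum_le_sum haffil) hlam.le)
  exact ⟨hval, hval.not_gt⟩
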